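/- arXiv:2402.05990 — 3 statements merged into one kernel-verified Lean document; each statement's English description precedes it below -/
import Mathlib

section
/- Let U : ℕ → ℕ → Bool and k : ℕ → ℕ → ℕ → ℕ be computable functions such that every x ∈ ℕ belongs to some U_n = {z ∈ ℕ : U n z = true}, and whenever x ∈ U_m ∩ U_n then x ∈ U_{k x m n} and U_{k x m n} ⊆ U_m ∩ U_n. Let τ be the topology on ℕ generated by the sets U_n, and suppose (ℕ, τ) is T₁. Then either there is an infinite limit-computable set Y ⊆ ℕ whose subspace topology is discrete, or there is an infinite computable set Y ⊆ ℕ whose subspace topology is the cofinite topology. -/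
/-- The topology on ℕ generated by a computably presented countable family of basic sets
`U n = {z | U n z = true}` (a CSC space presentation). -/
def cscTop (U : ℕ → ℕ → Bool) : TopologicalSpace ℕ :=
  TopologicalSpace.generateFrom {s | ∃ n : ℕ, s = {z | U n z = true}}

section BoundedSearch

variable {α : Type*} [Primcodable α]

theorem Computable.decide_forall_lt {p : α → ℕ → Bool} {f : α → ℕ} (hp : Computable₂ p)
    (hf : Computable f) : Computable fun a => decide (∀ z < f a, p a z = true) := by
  have hstep : Computable₂ fun (a : α) (q : ℕ × Bool) => q.2 && p a q.1 :=
    (Primrec.and.to_comp).comp (Computable.snd.comp Computable.snd)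
      (hp.comp Computable.fst (Computable.fst.comp Computable.snd))
  refine (Computable.nat_rec hf (Computable.const true) hstep).of_eq fun a => ?_
  induction f a with
  | zero => simp
  | succ n ih =>
    simp only [ih]
    rw [Bool.eq_iff_iff]
    simp only [Bool.and_eq_true, decide_eq_true_eq, Nat.forall_lt_succ_right]

theorem Computable.decide_exists_lt {p : α → ℕ → Bool} {f : α → ℕ} (hp : Computable₂ p)
    (hf : Computable f) : Computable fun a => decide (∃ z < f a, p a z = true) := by
  have hn : Computable₂ fun a z => !p a z := Primrec.not.to_comp.comp hp
  refine (Primrec.not.to_comp.comp (Computable.decide_forall_lt hn hf)).of_eq fun a => ?_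
  rw [Bool.eq_iff_iff]
  simp

theorem Computable.nat_find {p : α → ℕ → Bool} (hp : Computable₂ p)
    (h : ∀ a, ∃ n, p a n = true) : Computable fun a => Nat.find (h a) := by
  have hr : Partrec fun a => Nat.rfind (fun n => (Part.some (p a n))) :=
    Partrec.rfind hp.partrec₂
  refine hr.of_eq fun a => ?_
  refine Part.eq_some_iff.2 (Nat.mem_rfind.2 ⟨?_, fun {m} hm => ?_⟩)
  · simpa using (Nat.find_spec (h a)).symm
  · simpa using (Nat.find_min (h a) hm)

theorem Computable₂.decide_nat_lt : Computable₂ fun a b : ℕ => decide (a < b) :=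
  (Primrec.nat_lt.decide).to_comp

theorem Computable₂.decide_nat_eq : Computable₂ fun a b : ℕ => decide (a = b) :=
  ((Primrec.eq (α := ℕ)).decide).to_comp

/-- Membership in the range of a sequence of functions, decided by a search below the argument. -/
theorem Computable₂.decide_mem_range {e : ℕ → ℕ → ℕ} (he : Computable₂ e) :
    Computable₂ fun x s : ℕ => decide (∃ i < x + 1, decide (e i s = x) = true) := by
  have h1 : Computable₂ fun (a : ℕ × ℕ) (i : ℕ) => decide (e i a.2 = a.1) :=
    Computable₂.decide_nat_eq.comp
      (he.comp Computable.snd (Computable.snd.comp Computable.fst))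
      (Computable.fst.comp Computable.fst)
  exact Computable.decide_exists_lt h1 (Computable.succ.comp Computable.fst)

end BoundedSearch

/-- Dependent choice along a `Π⁰₁` relation is limit computable: if `G` is closed under the relation
`∀ z, P c d z` and every point of `G` has a successor, then some infinite chain has a range (measured
by the strictly increasing value `X`) that is limit computable. -/
theorem exists_limitComputable_chain {P : ℕ → ℕ → ℕ → Bool} {X : ℕ → ℕ}
    (hP : Computable fun p : ℕ × ℕ × ℕ => P p.1 p.2.1 p.2.2) (hX : Computable X)
    (G : Set ℕ) {c₀ : ℕ} (h₀ : c₀ ∈ G) (hex : ∀ c ∈ G, ∃ d, ∀ z, P c d z = true)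
    (hG : ∀ c ∈ G, ∀ d, (∀ z, P c d z = true) → d ∈ G ∧ X c < X d) :
    ∃ c : ℕ → ℕ, (∀ i, c i ∈ G ∧ ∀ z, P (c i) (c (i + 1)) z = true) ∧
      StrictMono (fun i => X (c i)) ∧
      ∃ g : ℕ → ℕ → Bool, Computable₂ g ∧
        ∀ x, ∃ N, ∀ s, N ≤ s → (g x s = true ↔ x ∈ Set.range fun i => X (c (i + 1))) := by
  classical
  let q : ℕ × ℕ → ℕ → Bool := fun a d =>
    decide (a.1 < d + 1) || decide (∀ z < a.1, P a.2 d z = true)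
  have hq : Computable₂ q := by
    refine Primrec.or.to_comp.comp (Computable₂.decide_nat_lt.comp
      (Computable.fst.comp Computable.fst) (Computable.succ.comp Computable.snd)) ?_
    have hp : Computable₂ fun (a : (ℕ × ℕ) × ℕ) (z : ℕ) => P a.1.2 a.2 z :=
      Computable.comp (g := fun b : ((ℕ × ℕ) × ℕ) × ℕ => (b.1.1.2, b.1.2, b.2)) hP
        (Computable.pair (Computable.snd.comp (Computable.fst.comp Computable.fst))
          (Computable.pair (Computable.snd.comp Computable.fst) Computable.snd))
    exact Computable.decide_forall_lt hp (Computable.fst.comp Computable.fst)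
  have hqe : ∀ a, ∃ d, q a d = true := fun a => ⟨a.1, by simp [q]⟩
  have hfind := Computable.nat_find hq hqe
  let e : ℕ → ℕ → ℕ := fun i s =>
    Nat.rec (motive := fun _ => ℕ) c₀ (fun _ c => Nat.find (hqe (s, c))) i
  have he : Computable₂ e := by
    have hstep : Computable₂ fun (p : ℕ × ℕ) (r : ℕ × ℕ) => Nat.find (hqe (p.2, r.2)) :=
      hfind.comp (Computable.pair (Computable.snd.comp Computable.fst)
        (Computable.snd.comp Computable.snd))
    exact Computable.nat_rec (α := ℕ × ℕ) Computable.fst (Computable.const c₀) hstep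
  choose! nxt hnxt using fun c (hc : c ∈ G) =>
    (⟨Nat.find (hex c hc), Nat.find_spec (hex c hc), fun d hd => Nat.find_min (hex c hc) hd⟩ :
      ∃ d, (∀ z, P c d z = true) ∧ ∀ d' < d, ¬ ∀ z, P c d' z = true)
  let c : ℕ → ℕ := fun i => Nat.rec (motive := fun _ => ℕ) c₀ (fun _ c => nxt c) i
  have hcG : ∀ i, c i ∈ G := by
    intro i
    induction i with
    | zero => exact h₀
    | succ i ih => exact (hG _ ih _ (hnxt _ ih).1).1
  have hmono : StrictMono fun i => X (c i) :=
    strictMono_nat_of_lt_succ fun i => (hG _ (hcG i) _ (hnxt _ (hcG i)).1).2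
  have hlim : ∀ i, ∀ᶠ s in Filter.atTop, e i s = c i := by
    intro i
    induction i with
    | zero => exact Filter.Eventually.of_forall fun _ => rfl
    | succ i ih =>
      have hbad : ∀ d ∈ Finset.range (c (i + 1)),
          ∀ᶠ s in Filter.atTop, ¬ ∀ z < s, P (c i) d z = true := by
        intro d hd
        have h := (hnxt _ (hcG i)).2 d (Finset.mem_range.1 hd)
        push Not at h
        obtain ⟨z, hz⟩ := h
        filter_upwards [Filter.eventually_gt_atTop z] with s hs h'
        exact hz (h' z hs)
      rw [← Filter.eventually_all_finset] at hbad
      filter_upwards [ih, hbad, Filter.eventually_ge_atTop (c (i + 1))] with s h1 h2 h3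
      change Nat.find (hqe (s, e i s)) = c (i + 1)
      rw [Nat.find_eq_iff, h1]
      refine ⟨?_, fun d hd => ?_⟩
      · simpa [q] using Or.inr fun z _ => (hnxt _ (hcG i)).1 z
      · have := h2 d (Finset.mem_range.2 hd)
        simp only [q, Bool.or_eq_true, decide_eq_true_eq, not_or]
        exact ⟨by omega, this⟩
  refine ⟨c, fun i => ⟨hcG i, (hnxt _ (hcG i)).1⟩, hmono, _, Computable₂.decide_mem_range
    (e := fun i s => X (e (i + 1) s)) (hX.comp (he.comp (Computable.succ.comp Computable.fst)
      Computable.snd)), fun x => ?_⟩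
  have hall : ∀ᶠ s in Filter.atTop, ∀ i ∈ Finset.range (x + 1), e (i + 1) s = c (i + 1) :=
    (Filter.eventually_all_finset _).2 fun i _ => hlim (i + 1)
  obtain ⟨N, hN⟩ := Filter.eventually_atTop.1 hall
  refine ⟨N, fun s hs => ?_⟩
  have hN := hN s hs
  simp only [decide_eq_true_eq, Set.mem_range]
  constructor
  · rintro ⟨i, hi, h⟩
    exact ⟨i, by rw [← hN i (Finset.mem_range.2 hi)]; exact h⟩
  · rintro ⟨i, h⟩
    have hi : i < x + 1 := by
      have h1 := hmono.le_apply (x := i + 1)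
      omega
    exact ⟨i, hi, by rw [hN i (Finset.mem_range.2 hi)]; exact h⟩

/-- A strictly increasing computable sequence has a computable range. -/
theorem computablePred_mem_range {y : ℕ → ℕ} (hy : Computable y) (hmono : StrictMono y) :
    ComputablePred (· ∈ Set.range y) := by
  classical
  have h := (Computable₂.decide_mem_range (e := fun i _ => y i) (hy.comp Computable.fst)).comp
    Computable.id (Computable.const 0)
  refine ⟨inferInstance, h.of_eq fun x => ?_⟩
  rw [Bool.eq_iff_iff]
  simp only [decide_eq_true_eq, Set.mem_range, id]
  constructor
  · rintro ⟨i, -, h⟩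
    exact ⟨i, h⟩
  · rintro ⟨i, h⟩
    have := hmono.le_apply (x := i)
    exact ⟨i, by omega, h⟩

section CSC

open scoped Topology

variable {U : ℕ → ℕ → Bool} {k : ℕ → ℕ → ℕ → ℕ}

theorem isOpen_basic (U : ℕ → ℕ → Bool) (n : ℕ) : IsOpen[cscTop U] {z | U n z = true} :=
  TopologicalSpace.isOpen_generateFrom_of_mem ⟨n, rfl⟩

theorem exists_basic_subset_of_isOpen (hcover : ∀ x : ℕ, ∃ n, U n x = true)
    (hinter : ∀ x m n : ℕ, U m x = true → U n x = true →
      U (k x m n) x = true ∧ ∀ z, U (k x m n) z = true → U m z = true ∧ U n z = true)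
    {V : Set ℕ} (hV : IsOpen[cscTop U] V) {x : ℕ} (hx : x ∈ V) :
    ∃ n, U n x = true ∧ ∀ z, U n z = true → z ∈ V := by
  let := cscTop U
  have hb : TopologicalSpace.IsTopologicalBasis {s | ∃ n : ℕ, s = {z | U n z = true}} := by
    refine ⟨?_, ?_, rfl⟩
    · rintro _ ⟨m, rfl⟩ _ ⟨n, rfl⟩ x ⟨hm, hn⟩
      exact ⟨_, ⟨k x m n, rfl⟩, (hinter x m n hm hn).1, (hinter x m n hm hn).2⟩
    · refine Set.eq_univ_of_forall fun x => ?_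
      obtain ⟨n, hn⟩ := hcover x
      exact ⟨_, ⟨n, rfl⟩, hn⟩
  obtain ⟨_, ⟨n, rfl⟩, h1, h2⟩ := hb.exists_subset_of_mem_open hx hV
  exact ⟨n, h1, h2⟩

theorem infinite_of_isOpen_of_not_isolated {τ : TopologicalSpace ℕ} [T1Space ℕ] {V : Set ℕ}
    (hV : IsOpen V) (hne : V.Nonempty) (hiso : ∀ x ∈ V, ¬ IsOpen ({x} : Set ℕ)) :
    V.Infinite := by
  obtain ⟨x, hx⟩ := hne
  intro hfin
  refine hiso x hx ?_
  have h : IsOpen (V \ (V \ {x})) := hV.sdiff (hfin.subset Set.sdiff_subset).isClosed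
  rwa [Set.sdiff_sdiff_cancel_left (Set.singleton_subset_iff.2 hx)] at h

theorem isOpen_singleton_subtype {Y : Set ℕ}
    (h : ∀ x ∈ Y, ∃ n, U n x = true ∧ ∀ y ∈ Y, U n y = true → y = x) (x : Y) :
    @IsOpen Y (TopologicalSpace.induced Subtype.val (cscTop U)) {x} := by
  obtain ⟨n, hn, hn'⟩ := h x x.2
  refine ⟨_, isOpen_basic U n, ?_⟩
  ext y
  simp only [Set.mem_preimage, Set.mem_ofPred_eq, Set.mem_singleton_iff]
  exact ⟨fun hy => Subtype.ext (hn' y y.2 hy), fun hy => hy ▸ hn⟩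

/-- The isolated points, if infinite in number, contain an infinite limit computable set. -/
theorem exists_discrete_of_infinite_isolated (hU : Computable₂ U)
    (hcover : ∀ x : ℕ, ∃ n, U n x = true)
    (hinter : ∀ x m n : ℕ, U m x = true → U n x = true →
      U (k x m n) x = true ∧ ∀ z, U (k x m n) z = true → U m z = true ∧ U n z = true)
    (hinf : {x | IsOpen[cscTop U] {x}}.Infinite) :
    ∃ Y : Set ℕ, Y.Infinite ∧
      (∃ g : ℕ → ℕ → Bool, Computable₂ g ∧
        ∀ x, ∃ N, ∀ s, N ≤ s → (g x s = true ↔ x ∈ Y)) ∧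
      ∀ x : Y, @IsOpen Y (TopologicalSpace.induced Subtype.val (cscTop U)) {x} := by
  let P : ℕ → ℕ → ℕ → Bool := fun c d z => decide (c.unpair.1 < d.unpair.1) &&
    (U d.unpair.2 d.unpair.1 && (!U d.unpair.2 z || decide (z = d.unpair.1)))
  have hl : Computable fun n : ℕ => n.unpair.1 := (Primrec.fst.comp Primrec.unpair).to_comp
  have hr : Computable fun n : ℕ => n.unpair.2 := (Primrec.snd.comp Primrec.unpair).to_comp
  have hc : Computable fun p : ℕ × ℕ × ℕ => p.1 := Computable.fst
  have hd : Computable fun p : ℕ × ℕ × ℕ => p.2.1 := Computable.fst.comp Computable.snd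
  have hz : Computable fun p : ℕ × ℕ × ℕ => p.2.2 := Computable.snd.comp Computable.snd
  have hP : Computable fun p : ℕ × ℕ × ℕ => P p.1 p.2.1 p.2.2 :=
    Primrec.and.to_comp.comp (Computable₂.decide_nat_lt.comp (hl.comp hc) (hl.comp hd))
      (Primrec.and.to_comp.comp (hU.comp (hr.comp hd) (hl.comp hd))
        (Primrec.or.to_comp.comp (Primrec.not.to_comp.comp (hU.comp (hr.comp hd) hz))
          (Computable₂.decide_nat_eq.comp hz (hl.comp hd))))
  have hP_iff : ∀ c d, (∀ z, P c d z = true) ↔ c.unpair.1 < d.unpair.1 ∧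
      U d.unpair.2 d.unpair.1 = true ∧ ∀ z, U d.unpair.2 z = true → z = d.unpair.1 := by
    intro c d
    simp only [P, Bool.and_eq_true, decide_eq_true_eq, forall_and, forall_const,
      Bool.or_eq_true, Bool.not_eq_true', ← Bool.not_eq_true, imp_iff_not_or]
  obtain ⟨c, hchain, hmono, hg⟩ := exists_limitComputable_chain hP hl Set.univ
    (Set.mem_univ 0) (fun c _ => by
      obtain ⟨x, hx, hlt⟩ := hinf.exists_gt c.unpair.1
      obtain ⟨n, hn, hn'⟩ := exists_basic_subset_of_isOpen hcover hinter hx rfl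
      exact ⟨Nat.pair x n, (hP_iff _ _).2 (by simpa using ⟨hlt, hn, hn'⟩)⟩)
    (fun c _ d h => ⟨Set.mem_univ _, ((hP_iff c d).1 h).1⟩)
  refine ⟨_, Set.infinite_range_of_injective
    (hmono.comp (strictMono_id.add_const 1)).injective, hg, isOpen_singleton_subtype ?_⟩
  rintro _ ⟨i, rfl⟩
  obtain ⟨-, h1, h2⟩ := (hP_iff _ _).1 (hchain i).2
  exact ⟨_, h1, fun y _ hy => h2 y hy⟩

/-- If every basic set in a perfect open set splits, meaning that it contains two nonempty disjoint
basic sets, then the points chosen in nested splittings form a limit computable discrete set. -/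
theorem exists_discrete_of_splitting (hU : Computable₂ U)
    (hinter : ∀ x m n : ℕ, U m x = true → U n x = true →
      U (k x m n) x = true ∧ ∀ z, U (k x m n) z = true → U m z = true ∧ U n z = true)
    {p : ℕ → Prop} (hinf : ∀ m x, U m x = true → (∀ z, U m z = true → p z) →
      {z | U m z = true}.Infinite)
    {m₀ x₀ : ℕ} (hx₀ : U m₀ x₀ = true) (hm₀ : ∀ z, U m₀ z = true → p z)
    (hsplit : ∀ m x, U m x = true → (∀ z, U m z = true → p z) →
      ∃ a b, (∃ x, U a x = true ∧ U m x = true) ∧ (∃ x, U b x = true ∧ U m x = true) ∧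
        ∀ x, U a x = true → U b x = true → ¬ U m x = true) :
    ∃ Y : Set ℕ, Y.Infinite ∧
      (∃ g : ℕ → ℕ → Bool, Computable₂ g ∧
        ∀ x, ∃ N, ∀ s, N ≤ s → (g x s = true ↔ x ∈ Y)) ∧
      ∀ x : Y, @IsOpen Y (TopologicalSpace.induced Subtype.val (cscTop U)) {x} := by
  have hl : Computable fun n : ℕ => n.unpair.1 := (Primrec.fst.comp Primrec.unpair).to_comp
  have hr : Computable fun n : ℕ => n.unpair.2 := (Primrec.snd.comp Primrec.unpair).to_comp
  -- A state codes a point, its neighbourhood, the remaining open set and a point of the latter.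
  obtain ⟨X, A, M, W, hX, hA, hM, hW, hcode⟩ : ∃ X A M W : ℕ → ℕ,
      Computable X ∧ Computable A ∧ Computable M ∧ Computable W ∧
      ∀ x a m w, ∃ d, X d = x ∧ A d = a ∧ M d = m ∧ W d = w :=
    ⟨_, _, _, _, hl, hl.comp hr, hl.comp (hr.comp hr), hr.comp (hr.comp hr),
      fun x a m w => ⟨Nat.pair x (Nat.pair a (Nat.pair m w)), by simp⟩⟩
  let P : ℕ → ℕ → ℕ → Bool := fun c d z => decide (X c < X d) &&
    (U (A d) (X d) && (U (M d) (W d) && ((!U (M d) z || U (M c) z) &&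
      (!U (A d) z || (U (M c) z && !U (M d) z)))))
  have hc : Computable fun p : ℕ × ℕ × ℕ => p.1 := Computable.fst
  have hd : Computable fun p : ℕ × ℕ × ℕ => p.2.1 := Computable.fst.comp Computable.snd
  have hz : Computable fun p : ℕ × ℕ × ℕ => p.2.2 := Computable.snd.comp Computable.snd
  have hP : Computable fun p : ℕ × ℕ × ℕ => P p.1 p.2.1 p.2.2 := by
    have hUc := hU.comp (hM.comp hc) hz
    have hUd := Primrec.not.to_comp.comp (hU.comp (hM.comp hd) hz)
    exact Primrec.and.to_comp.comp (Computable₂.decide_nat_lt.comp (hX.comp hc) (hX.comp hd))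
      (Primrec.and.to_comp.comp (hU.comp (hA.comp hd) (hX.comp hd))
        (Primrec.and.to_comp.comp (hU.comp (hM.comp hd) (hW.comp hd))
          (Primrec.and.to_comp.comp (Primrec.or.to_comp.comp hUd hUc)
            (Primrec.or.to_comp.comp (Primrec.not.to_comp.comp (hU.comp (hA.comp hd) hz))
              (Primrec.and.to_comp.comp hUc hUd)))))
  have hP_iff : ∀ c d, (∀ z, P c d z = true) ↔ X c < X d ∧ U (A d) (X d) = true ∧
      U (M d) (W d) = true ∧ (∀ z, U (M d) z = true → U (M c) z = true) ∧
      ∀ z, U (A d) z = true → U (M c) z = true ∧ ¬ U (M d) z = true := by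
    intro c d
    simp only [P, Bool.and_eq_true, decide_eq_true_eq, forall_and, forall_const,
      Bool.or_eq_true, Bool.not_eq_true', ← Bool.not_eq_true, imp_iff_not_or, or_and_left]
  obtain ⟨c₀, -, -, hMc₀, hWc₀⟩ := hcode 0 0 m₀ x₀
  obtain ⟨c, hchain, hmono, hg⟩ := exists_limitComputable_chain hP hX
    {c | U (M c) (W c) = true ∧ ∀ z, U (M c) z = true → p z} (c₀ := c₀)
    (by rw [Set.mem_ofPred_eq, hMc₀, hWc₀]; exact ⟨hx₀, hm₀⟩)
    (fun c hc => by
      obtain ⟨a, b, ⟨x, hax, hmx⟩, ⟨y, hby, hmy⟩, hdisj⟩ := hsplit _ _ hc.1 hc.2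
      obtain ⟨ha, ha'⟩ := hinter x a (M c) hax hmx
      obtain ⟨hb, hb'⟩ := hinter y b (M c) hby hmy
      obtain ⟨x', hx', hlt⟩ := (hinf _ _ ha fun z hz => hc.2 z (ha' z hz).2).exists_gt (X c)
      obtain ⟨d, hXd, hAd, hMd, hWd⟩ := hcode x' (k x a (M c)) (k y b (M c)) y
      refine ⟨d, (hP_iff c d).2 ?_⟩
      rw [hXd, hAd, hMd, hWd]
      exact ⟨hlt, hx', hb, fun z hz => (hb' z hz).2, fun z hz => ⟨(ha' z hz).2,
        fun hz' => hdisj z (ha' z hz).1 (hb' z hz').1 (ha' z hz).2⟩⟩)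
    (fun c hc d h => by
      obtain ⟨h1, -, h3, h4, -⟩ := (hP_iff c d).1 h
      exact ⟨⟨h3, fun z hz => hc.2 z (h4 z hz)⟩, h1⟩)
  refine ⟨_, Set.infinite_range_of_injective
    (hmono.comp (strictMono_id.add_const 1)).injective, hg, isOpen_singleton_subtype ?_⟩
  have hstep := fun i => (hP_iff _ _).1 (hchain i).2
  have hanti : Antitone fun i => {z | U (M (c i)) z = true} :=
    antitone_nat_of_succ_le fun i => (hstep i).2.2.2.1
  have hmem : ∀ i, U (M (c i)) (X (c (i + 1))) = true := fun i =>
    ((hstep i).2.2.2.2 _ (hstep i).2.1).1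
  rintro _ ⟨i, rfl⟩
  refine ⟨A (c (i + 1)), (hstep i).2.1, ?_⟩
  rintro _ ⟨j, rfl⟩ hj
  obtain ⟨hj1, hj2⟩ := (hstep i).2.2.2.2 _ hj
  rcases lt_trichotomy i j with h | h | h
  · exact absurd (hanti (Nat.succ_le_of_lt h) (hmem j)) hj2
  · rw [h]
  · exact absurd (hanti (Nat.succ_le_of_lt h) hj1) ((hstep j).2.2.2.2 _ (hstep j).2.1).2

/-- In an infinite hyperconnected basic set without finite nonempty basic subsets one can compute a
sequence that is eventually in every nonempty basic set. -/
theorem exists_cofinite_of_hyperconnected (hU : Computable₂ U)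
    (hcover : ∀ x : ℕ, ∃ n, U n x = true)
    (hinter : ∀ x m n : ℕ, U m x = true → U n x = true →
      U (k x m n) x = true ∧ ∀ z, U (k x m n) z = true → U m z = true ∧ U n z = true)
    (hT1 : @T1Space ℕ (cscTop U)) {m x₀ : ℕ} (hx₀ : U m x₀ = true)
    (hinf : ∀ n x, U n x = true → (∀ z, U n z = true → U m z = true) →
      {z | U n z = true}.Infinite)
    (hyper : ∀ a b, (∃ x, U a x = true ∧ U m x = true) → (∃ x, U b x = true ∧ U m x = true) →
      ∃ x, U a x = true ∧ U b x = true ∧ U m x = true) :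
    ∃ Y : Set ℕ, Y.Infinite ∧ ComputablePred (· ∈ Y) ∧
      ∀ V : Set Y, @IsOpen Y (TopologicalSpace.induced Subtype.val (cscTop U)) V ↔
        V = ∅ ∨ Vᶜ.Finite := by
  classical
  have hmeet : ∀ s, ∃ n, (∃ x, U n x = true) ∧ (∀ z, U n z = true → U m z = true) ∧
      ∀ i < s, (∃ x, U i x = true ∧ U m x = true) → ∀ z, U n z = true → U i z = true := by
    intro s
    induction s with
    | zero => exact ⟨m, ⟨x₀, hx₀⟩, fun _ => id, by simp⟩
    | succ s ih =>
      obtain ⟨n, ⟨x, hx⟩, hnm, hn⟩ := ih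
      by_cases hs : ∃ x, U s x = true ∧ U m x = true
      · obtain ⟨y, hy1, hy2, -⟩ := hyper n s ⟨x, hx, hnm x hx⟩ hs
        obtain ⟨h1, h2⟩ := hinter y n s hy1 hy2
        refine ⟨_, ⟨y, h1⟩, fun z hz => hnm z (h2 z hz).1, fun i hi hmi z hz => ?_⟩
        rcases Nat.lt_succ_iff_lt_or_eq.1 hi with hi | rfl
        · exact hn i hi hmi z (h2 z hz).1
        · exact (h2 z hz).2
      · refine ⟨n, ⟨x, hx⟩, hnm, fun i hi hmi => ?_⟩
        rcases Nat.lt_succ_iff_lt_or_eq.1 hi with hi | rfl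
        · exact hn i hi hmi
        · exact absurd hmi hs
  -- `seen i s`: the intersection of the basic sets `i` and `m` has an element below `s`.
  let seen : ℕ → ℕ → Bool := fun i s => decide (∃ z < s, (U i z && U m z) = true)
  have hseen : Computable₂ seen := by
    have h : Computable₂ fun (a : ℕ × ℕ) (z : ℕ) => U a.1 z && U m z :=
      Primrec.and.to_comp.comp (hU.comp (Computable.fst.comp Computable.fst) Computable.snd)
        (hU.comp (Computable.const m) Computable.snd)
    exact Computable.decide_exists_lt h Computable.snd
  let q : ℕ × ℕ → ℕ → Bool := fun a y => decide (a.2 < y) && (U m y &&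
    decide (∀ i < a.1, (!seen i a.1 || U i y) = true))
  have hq : Computable₂ q := by
    have h : Computable₂ fun (b : (ℕ × ℕ) × ℕ) (i : ℕ) => !seen i b.1.1 || U i b.2 :=
      Primrec.or.to_comp.comp (Primrec.not.to_comp.comp (hseen.comp Computable.snd
          (Computable.fst.comp (Computable.fst.comp Computable.fst))))
        (hU.comp Computable.snd (Computable.snd.comp Computable.fst))
    exact Primrec.and.to_comp.comp (Computable₂.decide_nat_lt.comp
        (Computable.snd.comp Computable.fst) Computable.snd)
      (Primrec.and.to_comp.comp (hU.comp (Computable.const m) Computable.snd)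
        (Computable.decide_forall_lt h (Computable.fst.comp Computable.fst)))
  have hq_iff : ∀ s y y', q (s, y) y' = true ↔ y < y' ∧ U m y' = true ∧
      ∀ i < s, (∃ z < s, U i z = true ∧ U m z = true) → U i y' = true := by
    intro s y y'
    simp only [q, seen, Bool.and_eq_true, decide_eq_true_eq, Bool.or_eq_true,
      Bool.not_eq_true', decide_eq_false_iff_not, ← imp_iff_not_or]
  have hqe : ∀ a, ∃ y, q a y = true := by
    rintro ⟨s, y⟩
    obtain ⟨n, ⟨x, hx⟩, hnm, hn⟩ := hmeet s
    obtain ⟨y', hy', hlt⟩ := (hinf n x hx hnm).exists_gt y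
    exact ⟨y', (hq_iff _ _ _).2 ⟨hlt, hnm _ hy', fun i hi ⟨z, _, hz⟩ => hn i hi ⟨z, hz⟩ _ hy'⟩⟩
  let y : ℕ → ℕ := fun n =>
    Nat.rec (motive := fun _ => ℕ) 0 (fun s v => Nat.find (hqe (s, v))) n
  have hy : Computable y := by
    have hstep : Computable₂ fun (_ : ℕ) (r : ℕ × ℕ) => Nat.find (hqe (r.1, r.2)) :=
      (Computable.nat_find hq hqe).comp (Computable.pair
        (Computable.fst.comp Computable.snd) (Computable.snd.comp Computable.snd))
    exact Computable.nat_rec (α := ℕ) Computable.id (Computable.const 0) hstep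
  have hstep := fun s => (hq_iff s (y s) (y (s + 1))).1 (Nat.find_spec (hqe (s, y s)))
  have hmono : StrictMono y := strictMono_nat_of_lt_succ fun s => (hstep s).1
  have hmono' : StrictMono fun s => y (s + 1) := hmono.comp (strictMono_id.add_const 1)
  refine ⟨Set.range fun s => y (s + 1), Set.infinite_range_of_injective hmono'.injective,
    computablePred_mem_range (hy.comp Computable.succ) hmono', fun V => ⟨fun hV => ?_, ?_⟩⟩
  · rw [or_iff_not_imp_left]
    intro hne
    obtain ⟨⟨_, s₀, rfl⟩, hv⟩ := Set.nonempty_iff_ne_empty.2 hne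
    obtain ⟨W, hW, rfl⟩ := hV
    obtain ⟨n, hn, hnW⟩ := exists_basic_subset_of_isOpen hcover hinter hW hv
    refine Set.Finite.of_finite_image (f := Subtype.val) ?_ Subtype.val_injective.injOn
    refine ((Set.finite_lt_nat (n + y (s₀ + 1) + 1)).image fun s => y (s + 1)).subset ?_
    rintro _ ⟨⟨_, s, rfl⟩, hs, rfl⟩
    refine ⟨s, ?_, rfl⟩
    by_contra hlt
    have hlt : n + y (s₀ + 1) + 1 ≤ s := not_lt.1 hlt
    exact hs (hnW _ ((hstep s).2.2 n (by omega)
      ⟨y (s₀ + 1), by omega, hn, (hstep s₀).2.1⟩))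
  · let := cscTop U
    rintro (rfl | hfin)
    · exact isOpen_empty
    · exact isClosed_compl_iff.1 hfin.isClosed

end CSC

/-- Every infinite computable T₁ CSC space has an infinite limit-computable (Δ⁰₂) discrete
subspace, or an infinite computable subspace with the cofinite topology. -/
theorem computable_T1_csc_delta2_solution (U : ℕ → ℕ → Bool) (k : ℕ → ℕ → ℕ → ℕ)
    (hU : Computable₂ U)
    (hk : Computable fun p : ℕ × ℕ × ℕ => k p.1 p.2.1 p.2.2)
    (hcover : ∀ x : ℕ, ∃ n, U n x = true)
    (hinter : ∀ x m n : ℕ, U m x = true → U n x = true →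
      U (k x m n) x = true ∧ ∀ z, U (k x m n) z = true → U m z = true ∧ U n z = true)
    (hT1 : @T1Space ℕ (cscTop U)) :
    (∃ Y : Set ℕ,
      Y.Infinite ∧
      (∃ g : ℕ → ℕ → Bool, Computable₂ g ∧
        ∀ x, ∃ N, ∀ s, N ≤ s → (g x s = true ↔ x ∈ Y)) ∧
      ∀ x : Y, @IsOpen Y (TopologicalSpace.induced Subtype.val (cscTop U)) {x}) ∨
    (∃ Y : Set ℕ,
      Y.Infinite ∧ ComputablePred (· ∈ Y) ∧
      ∀ V : Set Y, @IsOpen Y (TopologicalSpace.induced Subtype.val (cscTop U)) V ↔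
        V = ∅ ∨ Vᶜ.Finite) := by
  by_cases hI : {x | @IsOpen ℕ (cscTop U) {x}}.Infinite
  · exact Or.inl (exists_discrete_of_infinite_isolated hU hcover hinter hI)
  rw [Set.not_infinite] at hI
  have hinf : ∀ m x, U m x = true → (∀ z, U m z = true → ¬ @IsOpen ℕ (cscTop U) {z}) →
      {z | U m z = true}.Infinite := fun m x hx hm =>
    infinite_of_isOpen_of_not_isolated (τ := cscTop U) (isOpen_basic U m) ⟨x, hx⟩ hm
  obtain ⟨x₀, hx₀⟩ := hI.infinite_compl.nonempty
  obtain ⟨m₀, hmx₀, hm₀⟩ := exists_basic_subset_of_isOpen hcover hinter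
    (@IsClosed.isOpen_compl _ (cscTop U) _ (@Set.Finite.isClosed _ (cscTop U) hT1 _ hI)) hx₀
  by_cases hyper : ∃ m x, U m x = true ∧ (∀ z, U m z = true → ¬ @IsOpen ℕ (cscTop U) {z}) ∧
      ∀ a b, (∃ x, U a x = true ∧ U m x = true) → (∃ x, U b x = true ∧ U m x = true) →
        ∃ x, U a x = true ∧ U b x = true ∧ U m x = true
  · obtain ⟨m, x, hx, hm, hyper⟩ := hyper
    exact Or.inr (exists_cofinite_of_hyperconnected hU hcover hinter hT1 hx
      (fun n y hy hnm => hinf n y hy fun z hz => hm z (hnm z hz)) hyper)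
  · push Not at hyper
    refine Or.inl (exists_discrete_of_splitting hU hinter hinf hmx₀ hm₀ fun m x hx hm => ?_)
    obtain ⟨a, b, ha, hb, hab⟩ := hyper m x hx hm
    exact ⟨a, b, ha, hb, fun x h1 h2 => by simpa using hab x h1 h2⟩
end

section
/- There exist computable functions U : ℕ → ℕ → Bool and k : ℕ → ℕ → ℕ → ℕ such that every x ∈ ℕ belongs to some U_n = {z ∈ ℕ : U n z = true}, whenever x ∈ U_m ∩ U_n then x ∈ U_{k x m n} ⊆ U_m ∩ U_n, the topology τ on ℕ generated by the sets U_n is T₁, and yet: no infinite computable set Y ⊆ ℕ has discrete subspace topology, and no infinite limit-computable set Y ⊆ ℕ has the cofinite subspace topology. -/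
open Nat.Partrec (Code)
open Denumerable (ofNat)

section ClaimTopology

variable {β : Type*} (pt : β → ℕ) (R : β → ℕ → Prop)

/-- The set attached to a claim `c` and a point `y`: it contains `pt c`, and moreover every point
other than `y` which is large enough to witness that `R c` fails somewhere. -/
def claimNhd (c : β × ℕ) : Set ℕ :=
  {z | z = pt c.1 ∨ (z ≠ c.2 ∧ ∃ b < z, ¬ R c.1 b)}

/-- The points `pt c` of the correct claims `c`. -/
def claimSet : Set ℕ := {x | ∃ c, (∀ b, R c b) ∧ pt c = x}

variable {pt R}

theorem claimNhd_eq_singleton {c : β × ℕ} (h : ∀ b, R c.1 b) : claimNhd pt R c = {pt c.1} := by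
  ext z
  simp [claimNhd, h]

theorem finite_compl_claimNhd {c : β × ℕ} {b : ℕ} (h : ¬ R c.1 b) :
    (claimNhd pt R c)ᶜ.Finite := by
  refine ((Set.finite_Iic b).union (Set.finite_singleton c.2)).subset fun z hz => ?_
  by_contra hz'
  simp only [Set.mem_union, Set.mem_Iic, Set.mem_singleton_iff, not_or, not_le] at hz'
  exact hz (Or.inr ⟨hz'.2, b, hz'.1, h⟩)

variable [Denumerable β]

variable (pt R) in
/-- The finite intersections of the sets `claimNhd pt R c`, indexed by codes of finite lists. -/
noncomputable def claimBasis (n z : ℕ) : Bool :=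
  open Classical in decide (∀ c ∈ ofNat (List (β × ℕ)) n, z ∈ claimNhd pt R c)

variable (β) in
/-- The index of an intersection of two basic sets. -/
def claimInter (m n : ℕ) : ℕ :=
  Encodable.encode (ofNat (List (β × ℕ)) m ++ ofNat (List (β × ℕ)) n)

theorem claimBasis_iff {n z : ℕ} :
    claimBasis pt R n z = true ↔ ∀ c ∈ ofNat (List (β × ℕ)) n, z ∈ claimNhd pt R c := by
  simp [claimBasis]

theorem claimBasis_claimInter {m n z : ℕ} :
    claimBasis pt R (claimInter β m n) z = true ↔
      claimBasis pt R m z = true ∧ claimBasis pt R n z = true := by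
  simp only [claimBasis_iff, claimInter, Denumerable.ofNat_encode, List.mem_append]
  grind

theorem claimBasis_singleton {c : β × ℕ} {z : ℕ} :
    claimBasis pt R (Encodable.encode [c]) z = true ↔ z ∈ claimNhd pt R c := by
  rw [claimBasis_iff, Denumerable.ofNat_encode]
  simp

theorem computable_claimBasis (hpt : Primrec pt) (hR : PrimrecRel R) :
    Computable₂ (claimBasis pt R) := by
  have h1 : PrimrecRel fun (b : ℕ) (p : β) => ¬ R p b :=
    (hR.comp Primrec.snd Primrec.fst).not
  have h2 : PrimrecRel fun (c : β × ℕ) (z : ℕ) => z ∈ claimNhd pt R c := by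
    have e1 : Primrec fun p : (β × ℕ) × ℕ => p.1.1 := Primrec.fst.comp Primrec.fst
    have e2 : Primrec fun p : (β × ℕ) × ℕ => p.1.2 := Primrec.snd.comp Primrec.fst
    have h3 : PrimrecPred fun p : (β × ℕ) × ℕ => ∃ b < p.2, ¬ R p.1.1 b :=
      (h1.exists_mem_list.comp (Primrec.list_range.comp Primrec.snd) e1).of_eq fun p => by simp
    exact (Primrec.eq.comp Primrec.snd (hpt.comp e1)).or
      ((Primrec.eq.comp Primrec.snd e2).not.and h3)
  have h3 : PrimrecRel fun (n z : ℕ) => ∀ c ∈ ofNat (List (β × ℕ)) n, z ∈ claimNhd pt R c :=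
    h2.forall_mem_list.comp ((Primrec.ofNat _).comp Primrec.fst) Primrec.snd
  obtain ⟨inst, h⟩ := h3
  refine Primrec₂.to_comp (Primrec.of_eq h fun p => ?_)
  simp [claimBasis]

theorem computable_claimInter :
    Computable fun p : ℕ × ℕ × ℕ => claimInter β p.2.1 p.2.2 :=
  (Primrec.encode.comp <| Primrec.list_append.comp
    ((Primrec.ofNat _).comp (Primrec.fst.comp Primrec.snd))
    ((Primrec.ofNat _).comp (Primrec.snd.comp Primrec.snd))).to_comp

theorem isOpen_claimNhd (c : β × ℕ) : @IsOpen ℕ (cscTop (claimBasis pt R)) (claimNhd pt R c) :=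
  TopologicalSpace.isOpen_generateFrom_of_mem
    ⟨Encodable.encode [c], by ext z; exact claimBasis_singleton.symm⟩

theorem t1Space_claimBasis (hpt : Function.Surjective pt) :
    @T1Space ℕ (cscTop (claimBasis pt R)) := by
  let _ := cscTop (claimBasis pt R)
  refine t1Space_iff_exists_open.2 fun x y hxy => ?_
  obtain ⟨c, rfl⟩ := hpt x
  refine ⟨claimNhd pt R (c, y), isOpen_claimNhd _, Or.inl rfl, ?_⟩
  rintro (h | h)
  · exact hxy h.symm
  · exact h.1 rfl

theorem isOpen_singleton_of_mem_claimSet {x : ℕ} (hx : x ∈ claimSet pt R) :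
    @IsOpen ℕ (cscTop (claimBasis pt R)) {x} := by
  obtain ⟨c, hc, rfl⟩ := hx
  rw [← claimNhd_eq_singleton (c := (c, 0)) hc]
  exact isOpen_claimNhd _

theorem finite_compl_of_isOpen {x : ℕ} (hx : x ∉ claimSet pt R) {V : Set ℕ}
    (hV : @IsOpen ℕ (cscTop (claimBasis pt R)) V) (hxV : x ∈ V) : Vᶜ.Finite := by
  induction hV with
  | basic s hs =>
    obtain ⟨n, rfl⟩ := hs
    have : {z | claimBasis pt R n z = true}ᶜ =
        ⋃ c ∈ {c | c ∈ ofNat (List (β × ℕ)) n}, (claimNhd pt R c)ᶜ := by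
      ext z
      simp [claimBasis_iff]
    rw [this]
    refine (List.finite_toSet _).biUnion fun c hc => ?_
    by_cases h : ∀ b, R c.1 b
    · have := claimBasis_iff.1 hxV c hc
      rw [claimNhd_eq_singleton h] at this
      exact absurd ⟨c.1, h, this.symm⟩ hx
    · obtain ⟨b, hb⟩ := not_forall.1 h
      exact finite_compl_claimNhd hb
  | univ => simp
  | inter s t _ _ hs ht =>
    rw [Set.compl_inter]
    exact (hs hxV.1).union (ht hxV.2)
  | sUnion S _ ih =>
    obtain ⟨s, hs, hxs⟩ := hxV
    exact (ih s hs hxs).subset (Set.compl_subset_compl.2 (Set.subset_sUnion_of_mem hs))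

theorem subset_claimSet_of_discrete {Y : Set ℕ} (hY : Y.Infinite)
    (hd : ∀ x : Y, @IsOpen Y (TopologicalSpace.induced Subtype.val (cscTop (claimBasis pt R))) {x}) :
    Y ⊆ claimSet pt R := by
  intro x hx
  by_contra hxA
  obtain ⟨V, hV, hVx⟩ := hd ⟨x, hx⟩
  have hxV : x ∈ V := by
    have : (⟨x, hx⟩ : Y) ∈ Subtype.val ⁻¹' V := by rw [hVx]; rfl
    exact this
  refine hY (((finite_compl_of_isOpen hxA hV hxV).union (Set.finite_singleton x)).subset ?_)
  intro y hy
  by_cases hyV : y ∈ V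
  · have : (⟨y, hy⟩ : Y) ∈ Subtype.val ⁻¹' V := hyV
    rw [hVx] at this
    exact Or.inr (congrArg Subtype.val this)
  · exact Or.inl hyV

theorem disjoint_claimSet_of_cofinite {Y : Set ℕ} (hY : Y.Infinite)
    (hc : ∀ V : Set Y, @IsOpen Y (TopologicalSpace.induced Subtype.val (cscTop (claimBasis pt R))) V →
      V = ∅ ∨ Vᶜ.Finite) :
    Disjoint Y (claimSet pt R) := by
  rw [Set.disjoint_left]
  intro x hx hxA
  have : Infinite Y := hY.to_subtype
  rcases hc (Subtype.val ⁻¹' {x}) ⟨{x}, isOpen_singleton_of_mem_claimSet hxA, rfl⟩ with h | h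
  · have : (⟨x, hx⟩ : Y) ∈ (∅ : Set Y) := by rw [← h]; rfl
    exact this
  · refine Set.infinite_univ (α := Y) ((h.union (Set.finite_singleton ⟨x, hx⟩)).subset fun y _ => ?_)
    by_cases hyx : (y : ℕ) = x
    · exact Or.inr (Subtype.ext hyx)
    · exact Or.inl hyx

end ClaimTopology

theorem exists_code_evaln_iff {f : ℕ → ℕ} (hf : Computable f) :
    ∃ e : ℕ, ∀ n m, (∃ t, Code.evaln t (ofNat Code e) n = some m) ↔ f n = m := by
  obtain ⟨c, hc⟩ := Code.exists_code.1 (Partrec.nat_iff.1 hf)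
  refine ⟨Encodable.encode c, fun n m => ?_⟩
  rw [Denumerable.ofNat_encode]
  refine Code.evaln_complete.symm.trans ?_
  rw [hc]
  simp [eq_comm]

theorem ComputablePred.exists_computable_strictMono {Y : Set ℕ} (hY : Y.Infinite)
    (hc : ComputablePred (· ∈ Y)) :
    ∃ f : ℕ → ℕ, Computable f ∧ StrictMono f ∧ ∀ n, f n ∈ Y := by
  obtain ⟨inst, hc⟩ := hc
  have hex : ∀ m, ∃ y, m < y ∧ y ∈ Y := fun m => (hY.exists_gt m).imp fun _ h => ⟨h.2, h.1⟩
  let next : ℕ → ℕ := fun m => Nat.find (hex m)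
  have hspec : ∀ m, m < next m ∧ next m ∈ Y := fun m => Nat.find_spec (hex m)
  have hnext : Computable next := by
    have hlt : Computable fun p : ℕ × ℕ => decide (p.1 < p.2) :=
      Primrec.to_comp (Primrec.nat_lt.decide)
    have hp : Computable₂ fun m y : ℕ => (decide (m < y) && decide (y ∈ Y)) :=
      (Primrec.and.to_comp.comp hlt (hc.comp Computable.snd) :)
    refine (Partrec.rfind hp.partrec₂).of_eq fun m => Part.eq_some_iff.2 ?_
    refine Nat.mem_rfind.2 ⟨?_, fun {k} hk => ?_⟩
    · simpa using hspec m
    · have : ¬ (m < k ∧ k ∈ Y) := Nat.find_min (hex m) hk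
      have : (decide (m < k) && decide (k ∈ Y)) = false := by simpa using this
      exact Part.mem_some_iff.2 this.symm
  let f : ℕ → ℕ := fun n => Nat.rec (next 0) (fun _ r => next r) n
  refine ⟨f, ?_, ?_, ?_⟩
  · exact Computable.nat_rec Computable.id (Computable.const _)
      (hnext.comp (Computable.snd.comp Computable.snd)).to₂
  · exact strictMono_nat_of_lt_succ fun n => (hspec (f n)).1
  · rintro (_ | n)
    · exact (hspec 0).2
    · exact (hspec (f n)).2

/-- `b = ⟨t, s⟩` refutes the candidate `q = ⟨x, N⟩` of the `e`-th function: within `t` steps, either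
that function takes the value `0` at `⟨x, s⟩` with `N ≤ s`, or `x` is the value of the `i`-th
function at `j`, where `s = ⟨i, j⟩` and `j ≤ i ≤ e`. -/
def Refutes (e q b : ℕ) : Prop :=
  (q.unpair.2 ≤ b.unpair.2 ∧
    Code.evaln b.unpair.1 (ofNat Code e) (Nat.pair q.unpair.1 b.unpair.2) = some 0) ∨
  ((b.unpair.2.unpair.1 ≤ e ∧ b.unpair.2.unpair.2 ≤ b.unpair.2.unpair.1) ∧
    Code.evaln b.unpair.1 (ofNat Code b.unpair.2.unpair.1) b.unpair.2.unpair.2 = some q.unpair.1)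

/-- The claim `(e, q, w)` says that `q` is the least candidate of the `e`-th function that is not
refuted, `w` being a list of refutations of the smaller ones. -/
def LeastUnrefuted (c : ℕ × ℕ × List ℕ) (b : ℕ) : Prop :=
  ¬ Refutes c.1 c.2.1 b ∧ (c.2.1 ≤ b ∨ Refutes c.1 b (c.2.2.getD b 0))

/-- The point put forward by a claim. -/
def claimPoint (c : ℕ × ℕ × List ℕ) : ℕ := c.2.1.unpair.1

theorem primrecPred_refutes {α : Type*} [Primcodable α] {e q b : α → ℕ} (he : Primrec e)
    (hq : Primrec q) (hb : Primrec b) : PrimrecPred fun a => Refutes (e a) (q a) (b a) := by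
  have u1 : Primrec fun n : ℕ => n.unpair.1 := Primrec.fst.comp Primrec.unpair
  have u2 : Primrec fun n : ℕ => n.unpair.2 := Primrec.snd.comp Primrec.unpair
  have hx := u1.comp hq
  have ht := u1.comp hb
  have hs := u2.comp hb
  have hi := u1.comp hs
  have hj := u2.comp hs
  have hev {k m : α → ℕ} (hk : Primrec k) (hm : Primrec m) :
      Primrec fun a => Code.evaln (b a).unpair.1 (ofNat Code (k a)) (m a) :=
    Code.primrec_evaln.comp ((ht.pair ((Primrec.ofNat Code).comp hk)).pair hm)
  exact ((Primrec.nat_le.comp (u2.comp hq) hs).and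
      (Primrec.eq.comp (hev he (Primrec₂.natPair.comp hx hs)) (Primrec.const (some 0)))).or
    (((Primrec.nat_le.comp hi he).and (Primrec.nat_le.comp hj hi)).and
      (Primrec.eq.comp (hev hi hj) (Primrec.option_some.comp hx)))

theorem primrecRel_leastUnrefuted : PrimrecRel LeastUnrefuted := by
  have he : Primrec fun p : (ℕ × ℕ × List ℕ) × ℕ => p.1.1 := Primrec.fst.comp Primrec.fst
  have hq : Primrec fun p : (ℕ × ℕ × List ℕ) × ℕ => p.1.2.1 :=
    Primrec.fst.comp (Primrec.snd.comp Primrec.fst)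
  have hw : Primrec fun p : (ℕ × ℕ × List ℕ) × ℕ => p.1.2.2.getD p.2 0 :=
    (Primrec.list_getD 0).comp (Primrec.snd.comp (Primrec.snd.comp Primrec.fst)) Primrec.snd
  exact (primrecPred_refutes he hq Primrec.snd).not.and
    ((Primrec.nat_le.comp hq Primrec.snd).or (primrecPred_refutes he Primrec.snd hw))

theorem primrec_claimPoint : Primrec claimPoint :=
  Primrec.fst.comp (Primrec.unpair.comp (Primrec.fst.comp Primrec.snd))

theorem surjective_claimPoint : Function.Surjective claimPoint :=
  fun x => ⟨(0, Nat.pair x 0, []), by simp [claimPoint]⟩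

theorem mem_claimSet_leastUnrefuted {x : ℕ} :
    x ∈ claimSet claimPoint LeastUnrefuted ↔
      ∃ e q, Minimal (fun q => ∀ b, ¬ Refutes e q b) q ∧ q.unpair.1 = x := by
  simp only [minimal_iff_forall_lt]
  constructor
  · rintro ⟨⟨e, q, w⟩, hc, rfl⟩
    refine ⟨e, q, ⟨fun b => (hc b).1, fun r hr h => ?_⟩, rfl⟩
    exact (hc r).2.elim hr.not_ge (h _)
  · rintro ⟨e, q, ⟨hq, hmin⟩, rfl⟩
    have : ∀ r : Fin q, ∃ b, Refutes e r b := fun r => by simpa using hmin r.2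
    choose w hw using this
    refine ⟨(e, q, List.ofFn w), fun b => ⟨hq b, ?_⟩, rfl⟩
    rcases le_or_gt q b with hb | hb
    · exact Or.inl hb
    · right
      have := hw ⟨b, hb⟩
      simpa [List.getD_eq_getElem?_getD, hb] using this

theorem not_subset_claimSet_of_computablePred {Y : Set ℕ} (hY : Y.Infinite)
    (hc : ComputablePred (· ∈ Y)) : ¬ Y ⊆ claimSet claimPoint LeastUnrefuted := by
  intro hsub
  obtain ⟨f, hf, hmono, hfY⟩ := hc.exists_computable_strictMono hY
  obtain ⟨i, hi⟩ := exists_code_evaln_iff hf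
  have key : ∀ j, ∃ e q, Minimal (fun q => ∀ b, ¬ Refutes e q b) q ∧ q.unpair.1 = f j :=
    fun j => mem_claimSet_leastUnrefuted.1 (hsub (hfY j))
  choose e q hq hqf using key
  have hlt : ∀ j ≤ i, e j < i := by
    intro j hj
    by_contra! hle
    obtain ⟨t, ht⟩ := (hi j (f j)).2 rfl
    refine (hq j).prop (Nat.pair t (Nat.pair i j)) (Or.inr ?_)
    simp [hle, hj, ht, hqf]
  obtain ⟨j, -, j', -, hne, heq⟩ := Finset.exists_ne_map_eq_of_card_lt_of_maps_to
    (s := Finset.range (i + 1)) (t := Finset.range i) (f := e) (by simp)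
    (fun j hj => by
      have := hlt j (by simpa [Nat.lt_succ_iff] using hj)
      simpa using this)
  refine hne (hmono.injective ?_)
  have h' := hq j'
  rw [← heq] at h'
  have hqq : q j = q j' := by
    rcases le_total (q j) (q j') with h | h
    · exact le_antisymm h (h'.le_of_le (hq j).prop h)
    · exact le_antisymm ((hq j).le_of_le h'.prop h) h
  rw [← hqf, ← hqf, hqq]

theorem not_disjoint_claimSet_of_limitComputable {Y : Set ℕ} (hY : Y.Infinite) {g : ℕ → ℕ → Bool}
    (hg : Computable₂ g) (hlim : ∀ x, ∃ N, ∀ s, N ≤ s → (g x s = true ↔ x ∈ Y)) :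
    ¬ Disjoint Y (claimSet claimPoint LeastUnrefuted) := by
  have hG : Computable fun n : ℕ => (g n.unpair.1 n.unpair.2).toNat := by
    have h : Computable fun n : ℕ => g n.unpair.1 n.unpair.2 :=
      hg.comp (Computable.fst.comp Computable.unpair) (Computable.snd.comp Computable.unpair)
    exact ((Primrec.dom_bool Bool.toNat).to_comp.comp h)
  obtain ⟨e, he⟩ := exists_code_evaln_iff hG
  have hfin : {x | ∃ i ≤ e, ∃ j ≤ i, ∃ t, Code.evaln t (ofNat Code i) j = some x}.Finite := by
    have : {x | ∃ i ≤ e, ∃ j ≤ i, ∃ t, Code.evaln t (ofNat Code i) j = some x} =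
        ⋃ i ∈ Set.Iic e, ⋃ j ∈ Set.Iic i, {x | ∃ t, Code.evaln t (ofNat Code i) j = some x} := by
      ext x
      simp
    rw [this]
    refine (Set.finite_Iic e).biUnion fun i _ => (Set.finite_Iic i).biUnion fun j _ => ?_
    refine Set.Subsingleton.finite fun x hx y hy => ?_
    exact Part.mem_unique (Code.evaln_complete.2 hx) (Code.evaln_complete.2 hy)
  obtain ⟨x, hxY, hx⟩ := hY.exists_notMem_finite hfin
  obtain ⟨N, hN⟩ := hlim x
  have hex : ∃ q, ∀ b, ¬ Refutes e q b := by
    refine ⟨Nat.pair x N, fun b hb => ?_⟩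
    rcases hb with ⟨hle, hb⟩ | ⟨⟨h1, h2⟩, hb⟩
    · have := (he _ _).1 ⟨_, hb⟩
      simp only [Nat.unpair_pair] at hle this
      rw [(hN _ hle).2 hxY] at this
      simp at this
    · exact hx ⟨_, h1, _, h2, _, by simpa using hb⟩
  classical
  have hq := Nat.find_spec hex
  have hmin : Minimal (fun q => ∀ b, ¬ Refutes e q b) (Nat.find hex) :=
    ⟨hq, fun r hr _ => Nat.find_min' hex hr⟩
  generalize Nat.find hex = q at hq hmin
  refine Set.not_disjoint_iff.2
    ⟨q.unpair.1, ?_, mem_claimSet_leastUnrefuted.2 ⟨e, q, hmin, rfl⟩⟩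
  obtain ⟨M, hM⟩ := hlim q.unpair.1
  rw [← hM (max M q.unpair.2) (le_max_left _ _)]
  by_contra hfalse
  obtain ⟨t, ht⟩ := (he (Nat.pair q.unpair.1 (max M q.unpair.2)) 0).2 (by simpa using hfalse)
  refine hq (Nat.pair t (max M q.unpair.2)) (Or.inl ?_)
  simp [ht]

/-- There is an infinite computable T₁ CSC space having no infinite computable discrete
subspace and no infinite limit-computable (Δ⁰₂) subspace with the cofinite topology. -/
theorem computable_T1_csc_no_computable_discrete_no_delta2_cofinite :
    ∃ (U : ℕ → ℕ → Bool) (k : ℕ → ℕ → ℕ → ℕ),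
      Computable₂ U ∧
      (Computable fun p : ℕ × ℕ × ℕ => k p.1 p.2.1 p.2.2) ∧
      (∀ x : ℕ, ∃ n, U n x = true) ∧
      (∀ x m n : ℕ, U m x = true → U n x = true →
        U (k x m n) x = true ∧ ∀ z, U (k x m n) z = true → U m z = true ∧ U n z = true) ∧
      @T1Space ℕ (cscTop U) ∧
      (¬ ∃ Y : Set ℕ, Y.Infinite ∧ ComputablePred (· ∈ Y) ∧
        ∀ x : Y, @IsOpen Y (TopologicalSpace.induced Subtype.val (cscTop U)) {x}) ∧
      (¬ ∃ Y : Set ℕ, Y.Infinite ∧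
        (∃ g : ℕ → ℕ → Bool, Computable₂ g ∧
          ∀ x, ∃ N, ∀ s, N ≤ s → (g x s = true ↔ x ∈ Y)) ∧
        ∀ V : Set Y, @IsOpen Y (TopologicalSpace.induced Subtype.val (cscTop U)) V ↔
          V = ∅ ∨ Vᶜ.Finite) := by
  refine ⟨claimBasis claimPoint LeastUnrefuted, fun _ m n => claimInter (ℕ × ℕ × List ℕ) m n,
    computable_claimBasis primrec_claimPoint primrecRel_leastUnrefuted, computable_claimInter,
    fun x => ?_, fun x m n hm hn => ?_, t1Space_claimBasis surjective_claimPoint, ?_, ?_⟩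
  · exact ⟨Encodable.encode ([] : List ((ℕ × ℕ × List ℕ) × ℕ)), by
      rw [claimBasis_iff, Denumerable.ofNat_encode]; simp⟩
  · exact ⟨claimBasis_claimInter.2 ⟨hm, hn⟩, fun z => claimBasis_claimInter.1⟩
  · rintro ⟨Y, hY, hc, hd⟩
    exact not_subset_claimSet_of_computablePred hY hc (subset_claimSet_of_discrete hY hd)
  · rintro ⟨Y, hY, ⟨g, hg, hlim⟩, hc⟩
    exact not_disjoint_claimSet_of_limitComputable hY hg hlim
      (disjoint_claimSet_of_cofinite hY fun V => (hc V).1)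
end

section
/- Let U : ℕ → ℕ → Bool and k : ℕ → ℕ → ℕ → ℕ be computable functions such that every x ∈ ℕ belongs to some U_n = {z ∈ ℕ : U n z = true}, and whenever x ∈ U_m ∩ U_n then x ∈ U_{k x m n} ⊆ U_m ∩ U_n. Suppose the topology τ on ℕ generated by the sets U_n is Hausdorff (T₂). Then there is an infinite computable set Y ⊆ ℕ whose subspace topology is discrete. -/
section Computability

variable {α β : Type*} [Primcodable α] [Primcodable β]

theorem ComputablePred.comp_computable {p : β → Prop} (hp : ComputablePred p) {f : α → β}
    (hf : Computable f) : ComputablePred fun a => p (f a) := by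
  obtain ⟨_, h⟩ := hp
  exact ⟨inferInstance, h.comp hf⟩

theorem Computable.computablePred_eq_true {f : α → Bool} (hf : Computable f) :
    ComputablePred fun a => f a = true :=
  ComputablePred.computable_iff.2 ⟨f, hf, rfl⟩

theorem ComputablePred.and_of {p q : α → Prop} (hp : ComputablePred p) (hq : ComputablePred q) :
    ComputablePred fun a => p a ∧ q a := by
  obtain ⟨f, hf, rfl⟩ := ComputablePred.computable_iff.1 hp
  obtain ⟨g, hg, rfl⟩ := ComputablePred.computable_iff.1 hq
  exact ComputablePred.computable_iff.2
    ⟨fun a => f a && g a, Primrec.and.to_comp.comp hf hg, by simp⟩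

theorem ComputablePred.or_of {p q : α → Prop} (hp : ComputablePred p) (hq : ComputablePred q) :
    ComputablePred fun a => p a ∨ q a := by
  obtain ⟨f, hf, rfl⟩ := ComputablePred.computable_iff.1 hp
  obtain ⟨g, hg, rfl⟩ := ComputablePred.computable_iff.1 hq
  exact ComputablePred.computable_iff.2
    ⟨fun a => f a || g a, Primrec.or.to_comp.comp hf hg, by simp⟩

/-- Computable predicates are closed under bounded universal quantification. -/
theorem ComputablePred.forall_le {p : α × ℕ → Prop} (hp : ComputablePred p) {f : α → ℕ}
    (hf : Computable f) : ComputablePred fun a => ∀ z ≤ f a, p (a, z) := by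
  obtain ⟨q, hq, rfl⟩ := ComputablePred.computable_iff.1 hp
  refine ComputablePred.computable_iff.2
    ⟨fun a => Nat.rec true (fun z b => b && q (a, z)) (f a + 1),
      Computable.nat_rec (Computable.succ.comp hf) (Computable.const true)
        (Primrec.and.to_comp.comp (Computable.snd.comp Computable.snd)
          (hq.comp (Computable.pair Computable.fst (Computable.fst.comp Computable.snd)))).to₂, ?_⟩
  funext a
  have key : ∀ n : ℕ, (Nat.rec true (fun z b => b && q (a, z)) n : Bool) = true ↔
      ∀ z < n, q (a, z) = true := by
    intro n
    induction n with
    | zero => simp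
    | succ n ih => simp only [Bool.and_eq_true, ih, Nat.forall_lt_succ_right]
  exact propext (((key (f a + 1)).trans (by simp only [Nat.lt_succ_iff])).symm)

/-- Unbounded search for the least witness of a computable predicate is computable. -/
theorem ComputablePred.exists_computable_least {p : α × ℕ → Prop} (hp : ComputablePred p)
    (h : ∀ a, ∃ n, p (a, n)) :
    ∃ g : α → ℕ, Computable g ∧ ∀ a, p (a, g a) ∧ ∀ m < g a, ¬ p (a, m) := by
  classical
  obtain ⟨q, hq, rfl⟩ := ComputablePred.computable_iff.1 hp
  refine ⟨fun a => Nat.find (h a), ?_, fun a => ⟨Nat.find_spec (h a), fun m => Nat.find_min (h a)⟩⟩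
  have hr : Partrec₂ fun (a : α) (n : ℕ) => (Part.some (q (a, n)) : Part Bool) := hq
  refine (Partrec.rfind hr).of_eq_tot fun a => ?_
  refine Nat.mem_rfind.2 ⟨?_, fun {m} hm => ?_⟩
  · simpa using (Nat.find_spec (h a)).symm
  · simpa using Nat.find_min (h a) hm

/-- The range of a strictly increasing computable function is computable. -/
theorem StrictMono.computablePred_range {f : ℕ → ℕ} (hm : StrictMono f) (hf : Computable f) :
    ComputablePred (· ∈ Set.range f) := by
  have h : ComputablePred fun q : ℕ × ℕ => f q.2 = q.1 :=
    ((Primrec.beq (α := ℕ)).to_comp.comp (hf.comp Computable.snd)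
      Computable.fst).computablePred_eq_true.of_eq fun q => by simp
  refine (h.not.forall_le Computable.id).not.of_eq fun y => ?_
  simp only [id, not_forall, not_not, Set.mem_range]
  exact ⟨fun ⟨i, _, hi⟩ => ⟨i, hi⟩, fun ⟨i, hi⟩ => ⟨i, hi ▸ hm.le_apply, hi⟩⟩

end Computability

/-- The code `c` of a pair of basic sets looks, up to stage `t`, like a separation of `p` from `w`:
the two sets contain `p` and `w`, and have no common element `z ≤ t`. -/
def SeparatesUpTo (U : ℕ → ℕ → Bool) (p w t c : ℕ) : Prop :=
  U c.unpair.1 p = true ∧ U c.unpair.2 w = true ∧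
    ∀ z ≤ t, ¬ (U c.unpair.1 z = true ∧ U c.unpair.2 z = true)

theorem computablePred_separatesUpTo {U : ℕ → ℕ → Bool} (hU : Computable₂ U) (p : ℕ) :
    ComputablePred fun a : (ℕ × ℕ) × ℕ => SeparatesUpTo U p a.1.1 a.1.2 a.2 := by
  have h1 : Computable fun a : (ℕ × ℕ) × ℕ => a.2.unpair.1 :=
    Computable.fst.comp (Primrec.unpair.to_comp.comp Computable.snd)
  have h2 : Computable fun a : (ℕ × ℕ) × ℕ => a.2.unpair.2 :=
    Computable.snd.comp (Primrec.unpair.to_comp.comp Computable.snd)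
  refine (hU.comp h1 (Computable.const p)).computablePred_eq_true.and_of
    ((hU.comp h2 (Computable.fst.comp Computable.fst)).computablePred_eq_true.and_of
      (ComputablePred.forall_le
        (p := fun b : ((ℕ × ℕ) × ℕ) × ℕ =>
          ¬ (U b.1.2.unpair.1 b.2 = true ∧ U b.1.2.unpair.2 b.2 = true)) ?_
        (Computable.snd.comp Computable.fst)))
  exact ((hU.comp (h1.comp Computable.fst) Computable.snd).computablePred_eq_true.and_of
    (hU.comp (h2.comp Computable.fst) Computable.snd).computablePred_eq_true).not

theorem isTopologicalBasis_cscTop {U : ℕ → ℕ → Bool} {k : ℕ → ℕ → ℕ → ℕ}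
    (hcover : ∀ x : ℕ, ∃ n, U n x = true)
    (hinter : ∀ x m n : ℕ, U m x = true → U n x = true →
      U (k x m n) x = true ∧ ∀ z, U (k x m n) z = true → U m z = true ∧ U n z = true) :
    @TopologicalSpace.IsTopologicalBasis ℕ (cscTop U)
      {s | ∃ n : ℕ, s = {z | U n z = true}} := by
  let := cscTop U
  refine ⟨?_, ?_, rfl⟩
  · rintro _ ⟨m, rfl⟩ _ ⟨n, rfl⟩ x ⟨hm, hn⟩
    obtain ⟨h1, h2⟩ := hinter x m n hm hn
    exact ⟨_, ⟨k x m n, rfl⟩, h1, h2⟩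
  · refine Set.eq_univ_of_forall fun x => ?_
    obtain ⟨n, hn⟩ := hcover x
    exact ⟨_, ⟨n, rfl⟩, hn⟩

theorem isOpen_cscTop_basic (U : ℕ → ℕ → Bool) (n : ℕ) :
    @IsOpen ℕ (cscTop U) {z | U n z = true} :=
  TopologicalSpace.isOpen_generateFrom_of_mem ⟨n, rfl⟩

/-- In a Hausdorff space, some code separates two given distinct points at every stage. -/
theorem exists_forall_separatesUpTo {U : ℕ → ℕ → Bool} {k : ℕ → ℕ → ℕ → ℕ}
    (hcover : ∀ x : ℕ, ∃ n, U n x = true)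
    (hinter : ∀ x m n : ℕ, U m x = true → U n x = true →
      U (k x m n) x = true ∧ ∀ z, U (k x m n) z = true → U m z = true ∧ U n z = true)
    (hT2 : @T2Space ℕ (cscTop U)) {p w : ℕ} (hw : w ≠ p) :
    ∃ c, ∀ t, SeparatesUpTo U p w t c := by
  let := cscTop U
  have hb := isTopologicalBasis_cscTop hcover hinter
  obtain ⟨A, B, hA, hB, hp, hw, hAB⟩ := t2_separation hw.symm
  obtain ⟨_, ⟨m, rfl⟩, hm, hmA⟩ := hb.exists_subset_of_mem_open hp hA
  obtain ⟨_, ⟨n, rfl⟩, hn, hnB⟩ := hb.exists_subset_of_mem_open hw hB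
  refine ⟨Nat.pair m n, fun t => ?_⟩
  simp only [SeparatesUpTo, Nat.unpair_pair]
  exact ⟨hm, hn, fun z _ hz => Set.disjoint_left.1 hAB (hmA hz.1) (hnB hz.2)⟩

/-- Least witnesses of a decreasing family of predicates stabilize if some witness works at every
stage. -/
theorem exists_eventually_eq_least {P : ℕ → ℕ → Prop}
    (hanti : ∀ c s t, s ≤ t → P t c → P s c) (h : ∃ c, ∀ t, P t c) {g : ℕ → ℕ}
    (hg : ∀ t, P t (g t) ∧ ∀ m < g t, ¬ P t m) :
    ∃ c, (∀ t, P t c) ∧ ∃ T, ∀ t, T ≤ t → g t = c := by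
  classical
  refine ⟨Nat.find h, Nat.find_spec h, Filter.eventually_atTop.1 ?_⟩
  have hlt : ∀ c ∈ Set.Iio (Nat.find h), ∀ᶠ t in Filter.atTop, ¬ P t c := by
    intro c hc
    obtain ⟨s, hs⟩ := not_forall.1 (Nat.find_min h hc)
    exact Filter.eventually_atTop.2 ⟨s, fun t hst ht => hs (hanti c s t hst ht)⟩
  filter_upwards [((Set.finite_Iio _).eventually_all).2 hlt] with t ht
  refine le_antisymm (not_lt.1 fun hlt => (hg t).2 _ hlt (Nat.find_spec h t)) ?_
  exact not_lt.1 fun hlt => ht _ hlt (hg t).1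

/-- A point of `Y` with a neighbourhood meeting `Y` in a finite set is isolated in `Y`. -/
theorem isOpen_singleton_subtype_of_finite_inter {X : Type*} [TopologicalSpace X] [T1Space X]
    {Y O : Set X} (hO : IsOpen O) (x : Y) (hx : ↑x ∈ O) (hfin : (Y ∩ O).Finite) :
    IsOpen ({x} : Set Y) := by
  refine isOpen_singleton_of_finite_mem_nhds x
    ((hO.preimage continuous_subtype_val).mem_nhds hx) ?_
  refine Set.Finite.of_finite_image (hfin.subset ?_) Subtype.val_injective.injOn
  rintro _ ⟨y, hy, rfl⟩
  exact ⟨y.2, hy⟩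

/-- Every infinite computable Hausdorff CSC space has an infinite computable subset whose
subspace topology is discrete. -/
theorem computable_hausdorff_csc_computable_discrete_subspace
    (U : ℕ → ℕ → Bool) (k : ℕ → ℕ → ℕ → ℕ)
    (hU : Computable₂ U)
    (hk : Computable fun p : ℕ × ℕ × ℕ => k p.1 p.2.1 p.2.2)
    (hcover : ∀ x : ℕ, ∃ n, U n x = true)
    (hinter : ∀ x m n : ℕ, U m x = true → U n x = true →
      U (k x m n) x = true ∧ ∀ z, U (k x m n) z = true → U m z = true ∧ U n z = true)
    (hT2 : @T2Space ℕ (cscTop U)) :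
    ∃ Y : Set ℕ, Y.Infinite ∧ ComputablePred (· ∈ Y) ∧
      ∀ x : Y, @IsOpen Y (TopologicalSpace.induced Subtype.val (cscTop U)) {x} := by
  let := cscTop U
  by_cases hdisc : ∀ p : ℕ, IsOpen ({p} : Set ℕ)
  · refine ⟨Set.univ, Set.infinite_univ, ?_, fun x => ?_⟩
    · exact (Computable.const true).computablePred_eq_true.of_eq fun _ => by simp
    · exact isOpen_singleton_subtype_of_finite_inter (hdisc x) x rfl
        ((Set.finite_singleton _).inter_of_right _)
  obtain ⟨p, hp⟩ := not_forall.1 hdisc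
  have : (nhdsWithin p {p}ᶜ).NeBot := ⟨fun h => hp ((isOpen_singleton_iff_punctured_nhds p).2 h)⟩
  have hsep := fun w (hw : w ≠ p) => exists_forall_separatesUpTo hcover hinter hT2 hw
  have heq : ComputablePred fun w : ℕ => w = p :=
    ((Primrec.beq (α := ℕ)).to_comp.comp Computable.id
      (Computable.const p)).computablePred_eq_true.of_eq fun w => by simp
  obtain ⟨g, hgc, hg⟩ := ComputablePred.exists_computable_least
    (p := fun a : (ℕ × ℕ) × ℕ => a.1.1 = p ∨ SeparatesUpTo U p a.1.1 a.1.2 a.2)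
    ((heq.comp_computable (Computable.fst.comp Computable.fst)).or_of
      (computablePred_separatesUpTo hU p))
    (fun a => by
      by_cases ha : a.1 = p
      · exact ⟨0, Or.inl ha⟩
      · exact (hsep a.1 ha).imp fun c hc => Or.inr (hc a.2))
  have hgsep : ∀ w t, w ≠ p → SeparatesUpTo U p w t (g (w, t)) := fun w t hw =>
    (hg (w, t)).1.resolve_left hw
  obtain ⟨next, hnextc, hnext⟩ := ComputablePred.exists_computable_least
    (p := fun a : ℕ × ℕ => a.1 < a.2 ∧
      ∀ w ≤ a.1, w = p ∨ U (g (w, a.1)).unpair.1 a.2 = true)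
    ((Primrec.nat_lt.decide.to_comp.comp Computable.fst
      Computable.snd).computablePred_eq_true.of_eq (fun a => by simp) |>.and_of
      (ComputablePred.forall_le
        (p := fun b : (ℕ × ℕ) × ℕ => b.2 = p ∨ U (g (b.2, b.1.1)).unpair.1 b.1.2 = true)
        ((heq.comp_computable Computable.snd).or_of
          (hU.comp (Computable.fst.comp (Primrec.unpair.to_comp.comp
            (hgc.comp (Computable.snd.pair (Computable.fst.comp Computable.fst)))))
            (Computable.snd.comp Computable.fst)).computablePred_eq_true)
        Computable.fst))
    (fun y => by
      have hmem : (⋂ w ∈ Set.Iic y, {z | w = p ∨ U (g (w, y)).unpair.1 z = true}) ∈ nhds p := by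
        refine (Filter.biInter_mem (Set.finite_Iic y)).2 fun w _ => ?_
        by_cases hw : w = p
        · simp [hw]
        · exact Filter.mem_of_superset
            ((isOpen_cscTop_basic U _).mem_nhds (hgsep w y hw).1) fun z hz => Or.inr hz
      obtain ⟨z, hz, hyz⟩ := (infinite_of_mem_nhds p hmem).exists_gt y
      exact ⟨z, hyz, fun w hw => Set.mem_iInter₂.1 hz w hw⟩)
  let f : ℕ → ℕ := fun n => Nat.rec (p + 1) (fun _ y => next y) n
  have hfc : Computable f := Computable.nat_rec Computable.id (Computable.const _)
    (hnextc.comp (Computable.snd.comp Computable.snd)).to₂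
  have hmono : StrictMono f := strictMono_nat_of_lt_succ fun n => (hnext (f n)).1.1
  refine ⟨Set.range f, Set.infinite_range_of_injective hmono.injective,
    hmono.computablePred_range hfc, ?_⟩
  rintro ⟨_, i, rfl⟩
  have hip : f i ≠ p := by
    have : p + 1 ≤ f i := hmono.monotone (Nat.zero_le i)
    omega
  obtain ⟨c, hc, T, hT⟩ := exists_eventually_eq_least (P := fun t c => SeparatesUpTo U p (f i) t c)
    (fun c s t hst h => ⟨h.1, h.2.1, fun z hz => h.2.2 z (hz.trans hst)⟩) (hsep _ hip)
    (g := fun t => g (f i, t))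
    (fun t => ⟨hgsep _ t hip, fun m hm h => (hg (f i, t)).2 m hm (Or.inr h)⟩)
  refine isOpen_singleton_subtype_of_finite_inter (isOpen_cscTop_basic U c.unpair.2) _
    (hc 0).2.1 (((Set.finite_Iic (max i T)).image f).subset ?_)
  rintro _ ⟨⟨j, rfl⟩, hj⟩
  refine ⟨j, Set.mem_Iic.2 (not_lt.1 fun hlt => ?_), rfl⟩
  obtain ⟨n, rfl⟩ : ∃ n, j = n + 1 := ⟨j - 1, by omega⟩
  have hin : f i ≤ f n := hmono.monotone (by omega)
  have hTn : T ≤ f n := le_trans (by omega) (hmono.le_apply (x := n))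
  have hA := ((hnext (f n)).1.2 (f i) hin).resolve_left hip
  rw [show g (f i, f n) = c from hT _ hTn] at hA
  exact (hc (f (n + 1))).2.2 _ le_rfl ⟨hA, hj⟩
end
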